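/- Define the smoothing transform 𝔉_sm on Borel probability measures on [0,∞) as follows: 𝔉_sm μ is the pushforward of the product measure 𝔻 ⊗ Unif[0,1] ⊗ Unif[0,1] ⊗ μ ⊗ μ ⊗ μ under the map ((x,y),u,v,(d₁,d₂,d₃)) ↦ Σ_{k=1}^{3} √δ_k · d_k · 1{u ∈ I_k or v ∈ I_k}, where δ₁ = x, δ₂ = y, δ₃ = 1−x−y, I₁ = [0,δ₁), I₂ = [δ₁,δ₁+δ₂), I₃ = [δ₁+δ₂,1], and 𝔻 is the Dirichlet(1/2,1/2,1/2) distribution. If μ is a Borel probability measure on [0,∞) with μ ≠ δ₀ (the Dirac mass at 0) satisfying 𝔉_sm μ = μ, then there exists a constant α > 0 such that the pushforward of μ under the map x ↦ αx is the Rayleigh distribution. -/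

import Mathlib

open MeasureTheory Real Set

/-- The Rayleigh distribution: density `x e^(−x²/2)` on `(0,∞)` w.r.t. Lebesgue. -/
noncomputable def rayleigh : Measure ℝ :=
  volume.withDensity fun x =>
    ENNReal.ofReal (Set.indicator (Set.Ioi (0 : ℝ)) (fun y => y * Real.exp (-y ^ 2 / 2)) x)

/-- The `Dirichlet(1/2,1/2,1/2)` distribution on `ℝ²`: density
`(2π)⁻¹ (xy(1−x−y))^(−1/2)` on the open simplex w.r.t. 2-dim Lebesgue. -/
noncomputable def dirichletHalf : Measure (ℝ × ℝ) :=
  volume.withDensity fun p =>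
    ENNReal.ofReal
      (Set.indicator {q : ℝ × ℝ | 0 < q.1 ∧ 0 < q.2 ∧ q.1 + q.2 < 1}
        (fun q => (2 * π)⁻¹ * (q.1 * q.2 * (1 - q.1 - q.2)) ^ (-(1 / 2) : ℝ)) p)

/-- The uniform distribution on `[0,1]`. -/
noncomputable def unif01 : Measure ℝ := volume.restrict (Set.Icc (0 : ℝ) 1)

/-- The map `((x,y),u,v,(d₁,d₂,d₃)) ↦ Σₖ √δₖ · dₖ · 1{u ∈ Iₖ or v ∈ Iₖ}` where
`δ₁ = x`, `δ₂ = y`, `δ₃ = 1−x−y`, `I₁ = [0,δ₁)`, `I₂ = [δ₁,δ₁+δ₂)`, `I₃ = [δ₁+δ₂,1]`. -/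
noncomputable def smoothingMap : (ℝ × ℝ) × ℝ × ℝ × ℝ × ℝ × ℝ → ℝ := fun q =>
  let δ₁ := q.1.1
  let δ₂ := q.1.2
  let δ₃ := 1 - q.1.1 - q.1.2
  let u := q.2.1
  let v := q.2.2.1
  let d₁ := q.2.2.2.1
  let d₂ := q.2.2.2.2.1
  let d₃ := q.2.2.2.2.2
  Real.sqrt δ₁ * d₁ * (if u ∈ Set.Ico (0 : ℝ) δ₁ ∨ v ∈ Set.Ico (0 : ℝ) δ₁ then 1 else 0) +
  Real.sqrt δ₂ * d₂ * (if u ∈ Set.Ico δ₁ (δ₁ + δ₂) ∨ v ∈ Set.Ico δ₁ (δ₁ + δ₂) then 1 else 0) +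
  Real.sqrt δ₃ * d₃ * (if u ∈ Set.Icc (δ₁ + δ₂) 1 ∨ v ∈ Set.Icc (δ₁ + δ₂) 1 then 1 else 0)

/-- The smoothing transform `𝔉_sm` associated with the BCRT: the law of
`Σₖ √Δₖ Dₖ 1{Pₖ>0}` where `(Δ₁,Δ₂,Δ₃) ~ Dirichlet(1/2,1/2,1/2)`, `D₁,D₂,D₃` i.i.d.
with law `μ`, and, conditionally on `Δ`, `(P₁,P₂,P₃) ~ Multinomial(2;Δ₁,Δ₂,Δ₃)`,
realised via two independent uniforms `u,v` on `[0,1]`. -/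
noncomputable def Fsm (μ : Measure ℝ) : Measure ℝ :=
  Measure.map smoothingMap
    (dirichletHalf.prod (unif01.prod (unif01.prod (μ.prod (μ.prod μ)))))


set_option linter.unusedSimpArgs false

/-- Laplace transform, extended-nonnegative-real valued. -/
noncomputable def LL (μ : Measure ℝ) (t : ℝ) : ENNReal :=
  ∫⁻ d, ENNReal.ofReal (Real.exp (-(t * d))) ∂μ

lemma measurable_LL (μ : Measure ℝ) [IsProbabilityMeasure μ] : Measurable (LL μ) := by
  unfold LL
  apply Measurable.lintegral_prod_right'
    (f := fun z : ℝ × ℝ => ENNReal.ofReal (Real.exp (-(z.1 * z.2))))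
  fun_prop

lemma LL_zero (μ : Measure ℝ) [IsProbabilityMeasure μ] : LL μ 0 = 1 := by
  simp [LL]

lemma three_int (μ : Measure ℝ) [IsProbabilityMeasure μ] (t a b c : ℝ) :
    ∫⁻ q : ℝ × ℝ × ℝ, ENNReal.ofReal (Real.exp (-(t * (a * q.1 + b * q.2.1 + c * q.2.2))))
      ∂(μ.prod (μ.prod μ)) = LL μ (t * a) * (LL μ (t * b) * LL μ (t * c)) := by
  unfold LL
  rw [← lintegral_prod_mul (by fun_prop) (by fun_prop),
    ← lintegral_prod_mul (by fun_prop) (by fun_prop)]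
  refine lintegral_congr fun q => ?_
  rw [← ENNReal.ofReal_mul (by positivity), ← ENNReal.ofReal_mul (by positivity),
    ← Real.exp_add, ← Real.exp_add]
  congr 2
  ring

lemma unif_int (a b : ℝ) (ha : 0 ≤ a) (hb : 0 ≤ b) (hab : a + b ≤ 1) (h : ℝ → ENNReal)
    (c₁ c₂ c₃ : ENNReal) (h₁ : ∀ u ∈ Ico 0 a, h u = c₁) (h₂ : ∀ u ∈ Ico a (a + b), h u = c₂)
    (h₃ : ∀ u ∈ Icc (a + b) 1, h u = c₃) :
    ∫⁻ u, h u ∂unif01 = ENNReal.ofReal a * c₁ + ENNReal.ofReal b * c₂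
      + ENNReal.ofReal (1 - a - b) * c₃ := by
  unfold unif01
  have e1 : Icc (0 : ℝ) 1 = Ico 0 (a + b) ∪ Icc (a + b) 1 :=
    (Ico_union_Icc_eq_Icc (by linarith) hab).symm
  have e2 : Ico (0 : ℝ) (a + b) = Ico 0 a ∪ Ico a (a + b) :=
    (Ico_union_Ico_eq_Ico ha (by linarith)).symm
  rw [e1, lintegral_union measurableSet_Icc, e2, lintegral_union measurableSet_Ico,
    setLIntegral_congr_fun measurableSet_Ico h₁, setLIntegral_congr_fun measurableSet_Ico h₂,
    setLIntegral_congr_fun measurableSet_Icc h₃]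
  · simp only [lintegral_const, Measure.restrict_apply MeasurableSet.univ, univ_inter,
      Real.volume_Ico, Real.volume_Icc]
    rw [mul_comm c₁, mul_comm c₂, mul_comm c₃]
    have r1 : a - 0 = a := by ring
    have r2 : a + b - a = b := by ring
    have r3 : 1 - (a + b) = 1 - a - b := by ring
    rw [r1, r2, r3]
  · rw [Set.disjoint_left]; rintro x ⟨_, h1⟩ ⟨h2, _⟩; linarith
  · rw [Set.disjoint_left]; rintro x ⟨_, h1⟩ ⟨h2, _⟩; linarith

lemma measurable_smoothingMap : Measurable smoothingMap := by
  unfold smoothingMap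
  have hm : ∀ (f g h : (ℝ × ℝ) × ℝ × ℝ × ℝ × ℝ × ℝ → ℝ), Measurable f → Measurable g →
      Measurable h → MeasurableSet {q | f q ∈ Ico (g q) (h q)} := by
    intro f g h hf hg hh
    exact (measurableSet_le hg hf).inter (measurableSet_lt hf hh)
  have hm' : ∀ (f g h : (ℝ × ℝ) × ℝ × ℝ × ℝ × ℝ × ℝ → ℝ), Measurable f → Measurable g →
      Measurable h → MeasurableSet {q | f q ∈ Icc (g q) (h q)} := by
    intro f g h hf hg hh
    exact (measurableSet_le hg hf).inter (measurableSet_le hf hh)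
  refine Measurable.add (Measurable.add ?_ ?_) ?_
  · refine Measurable.mul (by fun_prop) (Measurable.ite ?_ measurable_const measurable_const)
    exact (hm _ _ _ (by fun_prop) (by fun_prop) (by fun_prop)).union
      (hm _ _ _ (by fun_prop) (by fun_prop) (by fun_prop))
  · refine Measurable.mul (by fun_prop) (Measurable.ite ?_ measurable_const measurable_const)
    exact (hm _ _ _ (by fun_prop) (by fun_prop) (by fun_prop)).union
      (hm _ _ _ (by fun_prop) (by fun_prop) (by fun_prop))
  · refine Measurable.mul (by fun_prop) (Measurable.ite ?_ measurable_const measurable_const)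
    exact (hm' _ _ _ (by fun_prop) (by fun_prop) (by fun_prop)).union
      (hm' _ _ _ (by fun_prop) (by fun_prop) (by fun_prop))

/-- Conditional Laplace transform given the Dirichlet variables. -/
noncomputable def KK (μ : Measure ℝ) (t x y z : ℝ) : ENNReal :=
  ENNReal.ofReal (x ^ 2) * LL μ (t * √x) + ENNReal.ofReal (y ^ 2) * LL μ (t * √y)
   + ENNReal.ofReal (z ^ 2) * LL μ (t * √z)
   + 2 * ENNReal.ofReal (x * y) * (LL μ (t * √x) * LL μ (t * √y))
   + 2 * ENNReal.ofReal (x * z) * (LL μ (t * √x) * LL μ (t * √z))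
   + 2 * ENNReal.ofReal (y * z) * (LL μ (t * √y) * LL μ (t * √z))

lemma cond_int (μ : Measure ℝ) [IsProbabilityMeasure μ] (t x y : ℝ) (hx : 0 ≤ x) (hy : 0 ≤ y)
    (hxy : x + y ≤ 1) :
    ∫⁻ r, ENNReal.ofReal (Real.exp (-(t * smoothingMap ((x, y), r))))
      ∂(unif01.prod (unif01.prod (μ.prod (μ.prod μ)))) = KK μ t x y (1 - x - y) := by
  have hsf : SFinite unif01 := by unfold unif01; infer_instance
  have hms : Measurable fun r => ENNReal.ofReal (Real.exp (-(t * smoothingMap ((x, y), r)))) := by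
    have := measurable_smoothingMap
    fun_prop
  set H : ℝ → ℝ → ENNReal := fun u v =>
    LL μ (t * (√x * (if u ∈ Set.Ico (0 : ℝ) x ∨ v ∈ Set.Ico (0 : ℝ) x then 1 else 0))) *
    (LL μ (t * (√y * (if u ∈ Set.Ico x (x + y) ∨ v ∈ Set.Ico x (x + y) then 1 else 0))) *
    LL μ (t * (√(1 - x - y) *
      (if u ∈ Set.Icc (x + y) 1 ∨ v ∈ Set.Icc (x + y) 1 then 1 else 0)))) with hH
  have s1 : ∫⁻ r, ENNReal.ofReal (Real.exp (-(t * smoothingMap ((x, y), r))))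
      ∂(unif01.prod (unif01.prod (μ.prod (μ.prod μ)))) = ∫⁻ u, ∫⁻ v, H u v ∂unif01 ∂unif01 := by
    rw [lintegral_prod _ hms.aemeasurable]
    refine lintegral_congr fun u => ?_
    rw [lintegral_prod _ (by
      have := measurable_smoothingMap
      fun_prop)]
    refine lintegral_congr fun v => ?_
    rw [hH]
    simp only
    rw [← three_int]
    refine lintegral_congr fun q => ?_
    simp only [smoothingMap]
    congr 4
    ring
  have c1 : ∀ u ∈ Ico (0:ℝ) x, u ∉ Ico x (x+y) ∧ u ∉ Icc (x+y) 1 := by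
    rintro u ⟨h1, h2⟩
    exact ⟨fun h => by linarith [h.1], fun h => by linarith [h.1]⟩
  have c2 : ∀ u ∈ Ico x (x+y), u ∉ Ico 0 x ∧ u ∉ Icc (x+y) 1 := by
    rintro u ⟨h1, h2⟩
    exact ⟨fun h => by linarith [h.2], fun h => by linarith [h.1]⟩
  have c3 : ∀ u ∈ Icc (x+y) 1, u ∉ Ico 0 x ∧ u ∉ Ico x (x+y) := by
    rintro u ⟨h1, h2⟩
    exact ⟨fun h => by linarith [h.2], fun h => by linarith [h.2]⟩
  set A := LL μ (t * √x)
  set B := LL μ (t * √y)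
  set C := LL μ (t * √(1 - x - y))
  have hA : ∀ u ∈ Ico (0:ℝ) x, ∫⁻ v, H u v ∂unif01 = ENNReal.ofReal x * A
      + ENNReal.ofReal y * (A * B) + ENNReal.ofReal (1 - x - y) * (A * C) := by
    intro u hu
    apply unif_int x y hx hy hxy
    · intro v hv
      simp [-Set.mem_Ico, -Set.mem_Icc, hH, hu, hv, c1 _ hu, c1 _ hv, LL_zero, A]
    · intro v hv
      simp [-Set.mem_Ico, -Set.mem_Icc, hH, hu, hv, c1 _ hu, c2 _ hv, LL_zero, A, B]
    · intro v hv
      simp [-Set.mem_Ico, -Set.mem_Icc, hH, hu, hv, c1 _ hu, c3 _ hv, LL_zero, A, C]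
  have hB : ∀ u ∈ Ico x (x+y), ∫⁻ v, H u v ∂unif01 = ENNReal.ofReal x * (A * B)
      + ENNReal.ofReal y * B + ENNReal.ofReal (1 - x - y) * (B * C) := by
    intro u hu
    apply unif_int x y hx hy hxy
    · intro v hv
      simp [-Set.mem_Ico, -Set.mem_Icc, hH, hu, hv, c2 _ hu, c1 _ hv, LL_zero, A, B]
    · intro v hv
      simp [-Set.mem_Ico, -Set.mem_Icc, hH, hu, hv, c2 _ hu, c2 _ hv, LL_zero, B]
    · intro v hv
      simp [-Set.mem_Ico, -Set.mem_Icc, hH, hu, hv, c2 _ hu, c3 _ hv, LL_zero, B, C]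
  have hC : ∀ u ∈ Icc (x+y) 1, ∫⁻ v, H u v ∂unif01 = ENNReal.ofReal x * (A * C)
      + ENNReal.ofReal y * (B * C) + ENNReal.ofReal (1 - x - y) * C := by
    intro u hu
    apply unif_int x y hx hy hxy
    · intro v hv
      simp [-Set.mem_Ico, -Set.mem_Icc, hH, hu, hv, c3 _ hu, c1 _ hv, LL_zero, A, C]
    · intro v hv
      simp [-Set.mem_Ico, -Set.mem_Icc, hH, hu, hv, c3 _ hu, c2 _ hv, LL_zero, B, C]
    · intro v hv
      simp [-Set.mem_Ico, -Set.mem_Icc, hH, hu, hv, c3 _ hu, c3 _ hv, LL_zero, C]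
  rw [s1, unif_int x y hx hy hxy _ _ _ _ hA hB hC]
  unfold KK
  rw [ENNReal.ofReal_mul hx, ENNReal.ofReal_mul hx, ENNReal.ofReal_mul hy,
    ENNReal.ofReal_pow hx, ENNReal.ofReal_pow hy, ENNReal.ofReal_pow (by linarith)]
  ring

/-- Dirichlet density. -/
noncomputable def dens (p : ℝ × ℝ) : ℝ :=
  Set.indicator {q : ℝ × ℝ | 0 < q.1 ∧ 0 < q.2 ∧ q.1 + q.2 < 1}
        (fun q => (2 * π)⁻¹ * (q.1 * q.2 * (1 - q.1 - q.2)) ^ (-(1 / 2) : ℝ)) p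

lemma measurable_dens : Measurable dens := by
  unfold dens
  have hS : MeasurableSet {q : ℝ × ℝ | 0 < q.1 ∧ 0 < q.2 ∧ q.1 + q.2 < 1} := (measurableSet_lt measurable_const measurable_fst).inter
    ((measurableSet_lt measurable_const measurable_snd).inter
      (measurableSet_lt (measurable_fst.add measurable_snd) measurable_const))
  exact Measurable.indicator (by fun_prop) hS

lemma LL_fix (μ : Measure ℝ) [IsProbabilityMeasure μ] (hfix : Fsm μ = μ) (t : ℝ) :
    LL μ t = ∫⁻ p : ℝ × ℝ, ENNReal.ofReal (dens p) * KK μ t p.1 p.2 (1 - p.1 - p.2) := by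
  have hsf : SFinite unif01 := by unfold unif01; infer_instance
  have hms : Measurable fun r => ENNReal.ofReal (Real.exp (-(t * smoothingMap r))) := by
    have := measurable_smoothingMap
    fun_prop
  have hL := measurable_LL μ
  have hD : dirichletHalf = volume.withDensity (fun p => ENNReal.ofReal (dens p)) := rfl
  have hKm : Measurable fun p : ℝ × ℝ => KK μ t p.1 p.2 (1 - p.1 - p.2) := by
    unfold KK
    fun_prop
  conv_lhs => rw [LL, ← hfix, Fsm]
  rw [lintegral_map (by fun_prop) measurable_smoothingMap,
    lintegral_prod _ hms.aemeasurable, hD,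
    lintegral_withDensity_eq_lintegral_mul₀ measurable_dens.ennreal_ofReal.aemeasurable
      hms.lintegral_prod_right'.aemeasurable]
  refine lintegral_congr fun p => ?_
  simp only [Pi.mul_apply]
  by_cases hp : 0 < p.1 ∧ 0 < p.2 ∧ p.1 + p.2 < 1
  · rw [← cond_int μ t p.1 p.2 hp.1.le hp.2.1.le hp.2.2.le]
  · have : dens p = 0 := by
      unfold dens
      rw [Set.indicator_of_notMem]
      exact hp
    simp [this]

/-- Gamma-type weights. -/
noncomputable def wp (l p X : ℝ) : ENNReal :=
  (Ioi (0:ℝ)).indicator (fun X => ENNReal.ofReal (X ^ p * Real.exp (-(l * X)))) X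

lemma measurable_wp (l p : ℝ) : Measurable (wp l p) := by
  unfold wp
  exact Measurable.indicator (by fun_prop) measurableSet_Ioi

lemma wp_pos {l p X : ℝ} (h : 0 < X) : wp l p X = ENNReal.ofReal (X ^ p * Real.exp (-(l * X))) :=
  Set.indicator_of_mem (show X ∈ Ioi (0:ℝ) from h) _

lemma wp_nonpos {l p X : ℝ} (h : ¬ 0 < X) : wp l p X = 0 :=
  Set.indicator_of_notMem (show X ∉ Ioi (0:ℝ) from h) _

lemma wp_mul_sq (l X : ℝ) : wp l (-(1/2)) X * ENNReal.ofReal (X ^ 2) = wp l (3/2) X := by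
  by_cases h : 0 < X
  · rw [wp_pos h, wp_pos h, ← ENNReal.ofReal_mul (by positivity)]
    congr 1
    have : X ^ (3/2 : ℝ) = X ^ (-(1/2) : ℝ) * X ^ 2 := by
      rw [← Real.rpow_natCast X 2, ← Real.rpow_add h]; norm_num
    rw [this]; ring
  · simp [wp_nonpos h]

lemma wp_mul_self (l X : ℝ) : wp l (-(1/2)) X * ENNReal.ofReal X = wp l (1/2) X := by
  by_cases h : 0 < X
  · rw [wp_pos h, wp_pos h, ← ENNReal.ofReal_mul (by positivity)]
    congr 1
    have : X ^ (1/2 : ℝ) = X ^ (-(1/2) : ℝ) * X := by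
      nth_rewrite 3 [← Real.rpow_one X]
      rw [← Real.rpow_add h]; norm_num
    rw [this]; ring
  · simp [wp_nonpos h]

lemma lintegral_scale (h : ℝ → ENNReal) (hh : Measurable h) {T : ℝ} (hT : 0 < T) :
    ∫⁻ x, h x = ∫⁻ X, ENNReal.ofReal T⁻¹ * h (X * T⁻¹) := by
  have hT' : T⁻¹ ≠ 0 := by positivity
  rw [lintegral_const_mul _ (by fun_prop), ← lintegral_map (g := fun X : ℝ => X * T⁻¹) hh (by fun_prop)]
  conv_lhs => rw [← Real.smul_map_volume_mul_right hT']
  rw [lintegral_smul_measure, abs_of_pos (by positivity), smul_eq_mul]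

lemma KK_scale (μ : Measure ℝ) {T X Y Z : ℝ} (hT : 0 < T) (hX : 0 < X) (hY : 0 < Y)
    (hZ : 0 < Z) : KK μ √T (X * T⁻¹) (Y * T⁻¹) (Z * T⁻¹) =
      ENNReal.ofReal (T⁻¹ ^ 2) * KK μ 1 X Y Z := by
  have hs : ∀ W : ℝ, 0 < W → √T * √(W * T⁻¹) = 1 * √W := by
    intro W hW
    rw [← Real.sqrt_mul hT.le, one_mul]
    congr 1
    field_simp
  unfold KK
  rw [hs X hX, hs Y hY, hs Z hZ]
  have e : ∀ U V : ℝ, 0 < U → 0 < V → ENNReal.ofReal (U * T⁻¹ * (V * T⁻¹)) =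
      ENNReal.ofReal (T⁻¹ ^ 2) * ENNReal.ofReal (U * V) := by
    intro U V hU hV
    rw [← ENNReal.ofReal_mul (by positivity)]
    congr 1; ring
  have e2 : ∀ U : ℝ, 0 < U → ENNReal.ofReal ((U * T⁻¹) ^ 2) =
      ENNReal.ofReal (T⁻¹ ^ 2) * ENNReal.ofReal (U ^ 2) := by
    intro U hU
    rw [← ENNReal.ofReal_mul (by positivity)]
    congr 1; ring
  rw [e X Y hX hY, e X Z hX hZ, e Y Z hY hZ, e2 X hX, e2 Y hY, e2 Z hZ]
  ring

/-- The integrand after scaling. -/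
noncomputable def Psi (μ : Measure ℝ) (l T X Y : ℝ) : ENNReal :=
  wp l (5/2) T * (ENNReal.ofReal T⁻¹ * (ENNReal.ofReal T⁻¹ *
    (ENNReal.ofReal (dens (X * T⁻¹, Y * T⁻¹)) *
      KK μ √T (X * T⁻¹) (Y * T⁻¹) (1 - X * T⁻¹ - Y * T⁻¹))))

lemma dens_pos {x y : ℝ} (hx : 0 < x) (hy : 0 < y) (hxy : x + y < 1) :
    dens (x, y) = (2 * π)⁻¹ * (x * y * (1 - x - y)) ^ (-(1 / 2) : ℝ) := by
  unfold dens
  rw [Set.indicator_of_mem]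
  exact ⟨hx, hy, hxy⟩

lemma dens_zero {x y : ℝ} (h : ¬ (0 < x ∧ 0 < y ∧ x + y < 1)) : dens (x, y) = 0 := by
  unfold dens
  rw [Set.indicator_of_notMem]
  exact h

lemma Psi_eq (μ : Measure ℝ) (l X Y Z : ℝ) :
    Psi μ l (Z + (X + Y)) X Y = ENNReal.ofReal (2 * π)⁻¹ *
      (wp l (-(1/2)) X * (wp l (-(1/2)) Y * (wp l (-(1/2)) Z * KK μ 1 X Y Z))) := by
  unfold Psi
  by_cases hT : 0 < Z + (X + Y)
  swap
  · rw [wp_nonpos hT]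
    by_cases hX : 0 < X
    · by_cases hY : 0 < Y
      · rw [wp_nonpos (show ¬ 0 < Z by intro h; apply hT; linarith)]
        simp
      · rw [wp_nonpos hY]; simp
    · rw [wp_nonpos hX]; simp
  set T := Z + (X + Y) with hTd
  by_cases hX : 0 < X
  swap
  · rw [wp_nonpos hX, dens_zero]
    · simp
    · rintro ⟨h, _⟩
      exact hX (by have := mul_pos h hT; rwa [mul_assoc, inv_mul_cancel₀ hT.ne', mul_one] at this)
  by_cases hY : 0 < Y
  swap
  · rw [wp_nonpos hY, dens_zero]
    · simp
    · rintro ⟨_, h, _⟩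
      exact hY (by have := mul_pos h hT; rwa [mul_assoc, inv_mul_cancel₀ hT.ne', mul_one] at this)
  have hz : 1 - X * T⁻¹ - Y * T⁻¹ = Z * T⁻¹ := by
    field_simp
    rw [hTd]; ring
  by_cases hZ : 0 < Z
  swap
  · rw [wp_nonpos hZ, dens_zero]
    · simp
    · rintro ⟨_, _, h⟩
      have h' : 0 < Z * T⁻¹ := by linarith
      exact hZ (by have := mul_pos h' hT; rwa [mul_assoc, inv_mul_cancel₀ hT.ne', mul_one] at this)
  have hzz : 0 < Z * T⁻¹ := by positivity
  rw [dens_pos (by positivity) (by positivity) (by linarith), hz, KK_scale μ hT hX hY hZ,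
    wp_pos hX, wp_pos hY, wp_pos hZ, wp_pos hT]
  simp only [← mul_assoc]
  congr 1
  rw [← ENNReal.ofReal_mul (by positivity), ← ENNReal.ofReal_mul (by positivity),
    ← ENNReal.ofReal_mul (by positivity), ← ENNReal.ofReal_mul (by positivity),
    ← ENNReal.ofReal_mul (by positivity), ← ENNReal.ofReal_mul (by positivity),
    ← ENNReal.ofReal_mul (by positivity)]
  congr 1
  have r1 : (X * T⁻¹ * Y * T⁻¹ * Z * T⁻¹) ^ (-(1/2) : ℝ) =
      X ^ (-(1/2) : ℝ) * Y ^ (-(1/2) : ℝ) * Z ^ (-(1/2) : ℝ) * T ^ (3/2 : ℝ) := by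
    have : X * T⁻¹ * Y * T⁻¹ * Z * T⁻¹ = X * Y * Z * (T ^ (-3 : ℝ)) := by
      rw [Real.rpow_neg hT.le]
      have : T ^ (3:ℝ) = T ^ 3 := by rw [← Real.rpow_natCast]; norm_num
      rw [this]; field_simp
    rw [this, Real.mul_rpow (by positivity) (by positivity),
      Real.mul_rpow (by positivity) (by positivity), Real.mul_rpow (by positivity) (by positivity),
      ← Real.rpow_mul hT.le]
    norm_num
  have r2 : T ^ (5/2 : ℝ) * T ^ (3/2 : ℝ) = T ^ 4 := by
    rw [← Real.rpow_add hT, ← Real.rpow_natCast]; norm_num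
  have r3 : Real.exp (-(l * T)) = Real.exp (-(l * X)) * Real.exp (-(l * Y)) * Real.exp (-(l * Z)) := by
    rw [← Real.exp_add, ← Real.exp_add, hTd]; congr 1; ring
  rw [r1, r3]
  have r4 : T ^ 4 * (T⁻¹ * T⁻¹ * T⁻¹ ^ 2) = 1 := by field_simp
  calc _ = (T ^ (5/2 : ℝ) * T ^ (3/2 : ℝ) * (T⁻¹ * T⁻¹ * T⁻¹ ^ 2)) * ((2 * π)⁻¹ *
      (X ^ (-(1/2) : ℝ) * Y ^ (-(1/2) : ℝ) * Z ^ (-(1/2) : ℝ)) *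
      (Real.exp (-(l * X)) * Real.exp (-(l * Y)) * Real.exp (-(l * Z)))) := by ring
    _ = _ := by rw [r2, r4]; ring

lemma measurable_Psi (μ : Measure ℝ) [IsProbabilityMeasure μ] (l : ℝ) :
    Measurable fun p : ℝ × ℝ × ℝ => Psi μ l p.1 p.2.1 p.2.2 := by
  have h1 := measurable_LL μ
  have h2 := measurable_wp l (5/2)
  have h3 := measurable_dens
  unfold Psi KK
  fun_prop

/-- Weighted integral of the Laplace transform. -/
noncomputable def NN (μ : Measure ℝ) (l p : ℝ) : ENNReal := ∫⁻ X, wp l p X * LL μ √X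

/-- Weighted integral of the constant. -/
noncomputable def BB (l : ℝ) : ENNReal := ∫⁻ X, wp l (-(1/2)) X

lemma NN_eq_Psi (μ : Measure ℝ) [IsProbabilityMeasure μ] (hfix : Fsm μ = μ) (l : ℝ) :
    NN μ l (5/2) = ∫⁻ X, ∫⁻ Y, ∫⁻ Z, Psi μ l (Z + (X + Y)) X Y := by
  have hPm := measurable_Psi μ l
  have h1 := measurable_LL μ
  have h3 := measurable_dens
  have step : NN μ l (5/2) = ∫⁻ T, ∫⁻ X, ∫⁻ Y, Psi μ l T X Y := by
    unfold NN
    refine lintegral_congr fun T => ?_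
    by_cases hT : 0 < T
    swap
    · simp [Psi, wp_nonpos hT]
    have hFm : Measurable fun p : ℝ × ℝ => ENNReal.ofReal (dens p) *
        KK μ √T p.1 p.2 (1 - p.1 - p.2) := by
      unfold KK; fun_prop
    rw [LL_fix μ hfix, Measure.volume_eq_prod, lintegral_prod _ hFm.aemeasurable,
      lintegral_scale _ hFm.lintegral_prod_right' hT]
    have : ∀ X, ∫⁻ Y, Psi μ l T X Y = wp l (5/2) T * (ENNReal.ofReal T⁻¹ *
        ∫⁻ y, ENNReal.ofReal (dens (X * T⁻¹, y)) *
          KK μ √T (X * T⁻¹) y (1 - X * T⁻¹ - y)) := by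
      intro X
      rw [lintegral_scale (fun y => ENNReal.ofReal (dens (X * T⁻¹, y)) *
          KK μ √T (X * T⁻¹) y (1 - X * T⁻¹ - y)) (by unfold KK; fun_prop) hT]
      unfold Psi
      rw [lintegral_const_mul _ (by unfold KK; fun_prop),
        lintegral_const_mul _ (by unfold KK; fun_prop)]
    simp_rw [this]
    have hm2 := (hFm.lintegral_prod_right' (ν := volume)).comp (by fun_prop : Measurable fun X : ℝ => X * T⁻¹)
    simp only [Function.comp_def] at hm2
    have hm3 : Measurable fun X : ℝ => ENNReal.ofReal T⁻¹ *
        ∫⁻ y, ENNReal.ofReal (dens (X * T⁻¹, y)) *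
          KK μ √T (X * T⁻¹) y (1 - X * T⁻¹ - y) := measurable_const.mul hm2
    exact (lintegral_const_mul _ hm3).symm
  rw [step, lintegral_lintegral_swap]
  · refine lintegral_congr fun X => ?_
    rw [lintegral_lintegral_swap]
    · refine lintegral_congr fun Y => ?_
      rw [lintegral_add_right_eq_self (fun T => Psi μ l T X Y) (X + Y)]
    · exact (hPm.comp (by fun_prop : Measurable fun p : ℝ × ℝ => (p.1, X, p.2))).aemeasurable
  · apply Measurable.aemeasurable
    have := Measurable.lintegral_prod_right' (ν := volume) (hPm.comp (by fun_prop : Measurable fun p : (ℝ × ℝ) × ℝ =>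
      (p.1.1, p.1.2, p.2)))
    exact this

lemma triple_int (f g h : ℝ → ENNReal) (hf : Measurable f) (hg : Measurable g)
    (hh : Measurable h) : ∫⁻ p : ℝ × ℝ × ℝ, f p.1 * (g p.2.1 * h p.2.2) =
      (∫⁻ x, f x) * ((∫⁻ x, g x) * (∫⁻ x, h x)) := by
  rw [← lintegral_prod_mul hg.aemeasurable hh.aemeasurable,
    ← lintegral_prod_mul hf.aemeasurable (by fun_prop)]
  rfl

lemma triple_meas (f g h : ℝ → ENNReal) (hf : Measurable f) (hg : Measurable g)
    (hh : Measurable h) : Measurable fun p : ℝ × ℝ × ℝ => f p.1 * (g p.2.1 * h p.2.2) := by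
  fun_prop

lemma sum_six {f₁ f₂ f₃ f₄ f₅ f₆ : ℝ × ℝ × ℝ → ENNReal} (_ : Measurable f₁)
    (h₂ : Measurable f₂) (h₃ : Measurable f₃) (h₄ : Measurable f₄) (h₅ : Measurable f₅)
    (h₆ : Measurable f₆) :
    ∫⁻ p, (f₁ p + f₂ p + f₃ p + 2 * f₄ p + 2 * f₅ p + 2 * f₆ p) =
      (∫⁻ p, f₁ p) + (∫⁻ p, f₂ p) + (∫⁻ p, f₃ p) + 2 * (∫⁻ p, f₄ p) + 2 * (∫⁻ p, f₅ p)
        + 2 * (∫⁻ p, f₆ p) := by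
  rw [lintegral_add_right _ (h₆.const_mul 2), lintegral_add_right _ (h₅.const_mul 2),
    lintegral_add_right _ (h₄.const_mul 2), lintegral_add_right _ h₃, lintegral_add_right _ h₂,
    lintegral_const_mul _ h₆, lintegral_const_mul _ h₅, lintegral_const_mul _ h₄]

lemma iter_three {F : ℝ × ℝ × ℝ → ENNReal} (hF : Measurable F) :
    ∫⁻ X, ∫⁻ Y, ∫⁻ Z, F (X, Y, Z) = ∫⁻ p, F p := by
  rw [Measure.volume_eq_prod, lintegral_prod _ hF.aemeasurable]
  refine lintegral_congr fun X => ?_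
  rw [Measure.volume_eq_prod, lintegral_prod _ (by fun_prop)]

lemma NN_key (μ : Measure ℝ) [IsProbabilityMeasure μ] (hfix : Fsm μ = μ) (l : ℝ) :
    NN μ l (5/2) = ENNReal.ofReal (2 * π)⁻¹ *
      (3 * NN μ l (3/2) * BB l ^ 2 + 6 * NN μ l (1/2) ^ 2 * BB l) := by
  have hL := measurable_LL μ
  have hw := measurable_wp l
  set b := wp l (-(1/2)) with hb
  set n3 := fun X => wp l (3/2) X * LL μ √X with hn3
  set n1 := fun X => wp l (1/2) X * LL μ √X with hn1
  have mb : Measurable b := hw _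
  have m3 : Measurable n3 := (hw _).mul (by fun_prop)
  have m1 : Measurable n1 := (hw _).mul (by fun_prop)
  have e : ∀ p : ℝ × ℝ × ℝ, b p.1 * (b p.2.1 * (b p.2.2 * KK μ 1 p.1 p.2.1 p.2.2)) =
      n3 p.1 * (b p.2.1 * b p.2.2) + b p.1 * (n3 p.2.1 * b p.2.2)
      + b p.1 * (b p.2.1 * n3 p.2.2) + 2 * (n1 p.1 * (n1 p.2.1 * b p.2.2))
      + 2 * (n1 p.1 * (b p.2.1 * n1 p.2.2)) + 2 * (b p.1 * (n1 p.2.1 * n1 p.2.2)) := by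
    rintro ⟨X, Y, Z⟩
    simp only [hn1, hn3, ← wp_mul_sq, ← wp_mul_self, ← hb]
    by_cases hX : 0 < X
    · by_cases hY : 0 < Y
      · unfold KK
        rw [ENNReal.ofReal_mul hX.le, ENNReal.ofReal_mul hX.le, ENNReal.ofReal_mul hY.le]
        simp only [one_mul]
        ring
      · have : b Y = 0 := wp_nonpos hY
        simp [this]
    · have : b X = 0 := wp_nonpos hX
      simp [this]
  have mK : Measurable fun p : ℝ × ℝ × ℝ =>
      b p.1 * (b p.2.1 * (b p.2.2 * KK μ 1 p.1 p.2.1 p.2.2)) := by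
    unfold KK; fun_prop
  rw [NN_eq_Psi μ hfix]
  simp_rw [Psi_eq]
  have : ∫⁻ X, ∫⁻ Y, ∫⁻ Z, ENNReal.ofReal (2 * π)⁻¹ *
      (b X * (b Y * (b Z * KK μ 1 X Y Z))) =
      ∫⁻ p : ℝ × ℝ × ℝ, ENNReal.ofReal (2 * π)⁻¹ *
        (b p.1 * (b p.2.1 * (b p.2.2 * KK μ 1 p.1 p.2.1 p.2.2))) := by
    exact iter_three (F := fun p : ℝ × ℝ × ℝ => ENNReal.ofReal (2 * π)⁻¹ *
        (b p.1 * (b p.2.1 * (b p.2.2 * KK μ 1 p.1 p.2.1 p.2.2)))) (mK.const_mul _)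
  rw [this, lintegral_const_mul _ mK]
  congr 1
  simp_rw [e]
  rw [sum_six (triple_meas _ _ _ m3 mb mb) (triple_meas _ _ _ mb m3 mb)
    (triple_meas _ _ _ mb mb m3) (triple_meas _ _ _ m1 m1 mb) (triple_meas _ _ _ m1 mb m1)
    (triple_meas _ _ _ mb m1 m1),
    triple_int _ _ _ m3 mb mb, triple_int _ _ _ mb m3 mb, triple_int _ _ _ mb mb m3,
    triple_int _ _ _ m1 m1 mb, triple_int _ _ _ m1 mb m1, triple_int _ _ _ mb m1 m1]
  change _ = 3 * (∫⁻ X, n3 X) * (∫⁻ X, b X) ^ 2 + 6 * (∫⁻ X, n1 X) ^ 2 * (∫⁻ X, b X)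
  ring

open Filter Topology

/-- Real-valued weighted integrals. -/
noncomputable def MM (ψ : ℝ → ℝ) (l p : ℝ) : ℝ :=
  ∫ X in Ioi (0:ℝ), X ^ p * Real.exp (-(l * X)) * ψ X

lemma gam_integral {l p : ℝ} (hl : 0 < l) (hp : -1 < p) :
    ∫ X in Ioi (0:ℝ), X ^ p * Real.exp (-(l * X)) = (1 / l) ^ (p + 1) * Real.Gamma (p + 1) := by
  have := Real.integral_rpow_mul_exp_neg_mul_Ioi (a := p + 1) (r := l) (by linarith) hl
  simpa using this

lemma gam_integrable {l p : ℝ} (hl : 0 < l) (hp : -1 < p) :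
    IntegrableOn (fun X : ℝ => X ^ p * Real.exp (-(l * X))) (Ioi 0) := by
  by_contra h
  have h1 := gam_integral hl hp
  rw [integral_undef h] at h1
  have : 0 < (1 / l) ^ (p + 1) * Real.Gamma (p + 1) :=
    mul_pos (by positivity) (Real.Gamma_pos_of_pos (by linarith))
  linarith

lemma MM_integrable {ψ : ℝ → ℝ} (hm : Measurable ψ) (h0 : ∀ X, 0 < ψ X) (h1 : ∀ X, ψ X ≤ 1)
    {l p : ℝ} (hl : 0 < l) (hp : -1 < p) :
    IntegrableOn (fun X : ℝ => X ^ p * Real.exp (-(l * X)) * ψ X) (Ioi 0) := by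
  refine Integrable.mono (gam_integrable hl hp) (by fun_prop) (Eventually.of_forall fun X => ?_)
  rw [norm_mul]
  refine mul_le_of_le_one_right (norm_nonneg _) ?_
  rw [Real.norm_eq_abs, abs_of_pos (h0 X)]
  exact h1 X

lemma MM_pos {ψ : ℝ → ℝ} (hm : Measurable ψ) (h0 : ∀ X, 0 < ψ X) (h1 : ∀ X, ψ X ≤ 1)
    {l p : ℝ} (hl : 0 < l) (hp : -1 < p) : 0 < MM ψ l p := by
  unfold MM
  rw [setIntegral_pos_iff_support_of_nonneg_ae]
  · have : Function.support (fun X : ℝ => X ^ p * Real.exp (-(l * X)) * ψ X) ∩ Ioi 0 = Ioi 0 := by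
      rw [Set.inter_eq_right]
      intro X hX
      have : 0 < X := hX
      have h2 := h0 X
      have : 0 < X ^ p * Real.exp (-(l * X)) * ψ X := by positivity
      exact this.ne'
    rw [this]; simp
  · filter_upwards [ae_restrict_mem measurableSet_Ioi] with X hX
    have : 0 < X := hX
    have h2 := h0 X
    show 0 ≤ X ^ p * Real.exp (-(l * X)) * ψ X
    positivity
  · exact MM_integrable hm h0 h1 hl hp

lemma MM_le {ψ : ℝ → ℝ} (hm : Measurable ψ) (h0 : ∀ X, 0 < ψ X) (h1 : ∀ X, ψ X ≤ 1)
    {l p : ℝ} (hl : 0 < l) (hp : -1 < p) :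
    MM ψ l p ≤ (1 / l) ^ (p + 1) * Real.Gamma (p + 1) := by
  rw [← gam_integral hl hp]
  refine setIntegral_mono_on (MM_integrable hm h0 h1 hl hp) (gam_integrable hl hp)
    measurableSet_Ioi fun X hX => ?_
  have : 0 < X := hX
  exact mul_le_of_le_one_right (by positivity) (h1 X)

lemma MM_deriv {ψ : ℝ → ℝ} (hm : Measurable ψ) (h0 : ∀ X, 0 < ψ X) (h1 : ∀ X, ψ X ≤ 1)
    {l p : ℝ} (hl : 0 < l) (hp : -1 < p) :
    HasDerivAt (fun l => MM ψ l p) (-MM ψ l (p + 1)) l := by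
  have key := (hasDerivAt_integral_of_dominated_loc_of_deriv_le
    (μ := volume.restrict (Ioi (0:ℝ))) (s := Ioi (l / 2)) (x₀ := l)
    (F := fun l X => X ^ p * Real.exp (-(l * X)) * ψ X)
    (F' := fun l X => -(X ^ (p + 1) * Real.exp (-(l * X)) * ψ X))
    (bound := fun X => X ^ (p + 1) * Real.exp (-(l / 2 * X)))
    (Ioi_mem_nhds (by linarith)) (Eventually.of_forall fun l => by fun_prop)
    (MM_integrable hm h0 h1 hl hp) (by fun_prop) ?_ (gam_integrable (by linarith) (by linarith))
    ?_).2
  · rw [integral_neg] at key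
    exact key
  · filter_upwards [ae_restrict_mem measurableSet_Ioi] with X hX x hx
    have hX : 0 < X := hX
    have hx : l / 2 < x := hx
    have h2 := h0 X
    rw [norm_neg, Real.norm_eq_abs, abs_of_nonneg (by positivity)]
    refine (mul_le_of_le_one_right (by positivity) (h1 X)).trans ?_
    gcongr
  · filter_upwards [ae_restrict_mem measurableSet_Ioi] with X hX x hx
    have hX : 0 < X := hX
    have : HasDerivAt (fun x : ℝ => Real.exp (-(x * X))) (Real.exp (-(x * X)) * (-(1 * X))) x :=
      ((hasDerivAt_id x).mul_const X).neg.exp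
    refine ((this.const_mul (X ^ p)).mul_const (ψ X)).congr_deriv ?_
    rw [Real.rpow_add hX, Real.rpow_one]
    ring

lemma ode_solve (f f' : ℝ → ℝ) (hf : ∀ y, 0 < y → HasDerivAt f (f' y) y)
    (hf' : ∀ y, 0 < y → HasDerivAt f' (6 * f y ^ 2) y) (hpos : ∀ y, 0 < y → 0 < f y)
    (hle : ∀ y, 0 < y → f y ≤ 1 / y ^ 2) (hlim : Tendsto f' atTop (𝓝 0)) :
    ∃ c : ℝ, 0 ≤ c ∧ ∀ y, 0 < y → f y = 1 / (y + c) ^ 2 := by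
  have hflim : Tendsto f atTop (𝓝 0) := by
    refine tendsto_of_tendsto_of_tendsto_of_le_of_le' tendsto_const_nhds
      (h := fun y : ℝ => 1 / y ^ 2) ?_ ?_ ?_
    · simp only [one_div]
      exact (tendsto_pow_atTop two_ne_zero).inv_tendsto_atTop
    · filter_upwards [eventually_gt_atTop 0] with y hy using (hpos y hy).le
    · filter_upwards [eventually_gt_atTop 0] with y hy using hle y hy
  have hconst : ∀ (g g' : ℝ → ℝ), (∀ y, 0 < y → HasDerivAt g 0 y) →
      ∀ a b, 0 < a → 0 < b → g a = g b := by
    intro g g' hg a b ha hb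
    refine (convex_Ioi (0:ℝ)).is_const_of_fderivWithin_eq_zero (𝕜 := ℝ) (f := g)
      (fun y hy => (hg y hy).differentiableAt.differentiableWithinAt) (fun y hy => ?_) ha hb
    rw [fderivWithin_of_isOpen isOpen_Ioi hy]
    ext
    simp [(hg y hy).deriv]
  -- energy
  have hE : ∀ y, 0 < y → f' y ^ 2 = 4 * f y ^ 3 := by
    have hc := hconst (fun y => f' y ^ 2 - 4 * f y ^ 3) 0 (fun y hy => by
      have := ((hf' y hy).pow 2).sub (((hf y hy).pow 3).const_mul 4)
      refine HasDerivAt.congr_deriv this ?_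
      push_cast
      ring)
    have hl : Tendsto (fun y => f' y ^ 2 - 4 * f y ^ 3) atTop (𝓝 0) := by
      have := (hlim.pow 2).sub ((hflim.pow 3).const_mul 4)
      simpa using this
    intro y hy
    have : Tendsto (fun y => f' y ^ 2 - 4 * f y ^ 3) atTop (𝓝 (f' y ^ 2 - 4 * f y ^ 3)) := by
      refine tendsto_const_nhds.congr' ?_
      filter_upwards [eventually_gt_atTop 0] with z hz using hc y z hy hz
    have := tendsto_nhds_unique this hl
    linarith
  have hmono : StrictMonoOn f' (Ioi 0) := by
    refine strictMonoOn_of_deriv_pos (convex_Ioi 0)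
      (fun y hy => (hf' y hy).continuousAt.continuousWithinAt) fun y hy => ?_
    rw [interior_Ioi] at hy
    rw [(hf' y hy).deriv]
    have := hpos y hy
    positivity
  have hneg : ∀ y, 0 < y → f' y < 0 := by
    intro y hy
    have h1 : f' y < f' (y + 1) := hmono hy (show (0:ℝ) < y + 1 by linarith) (by linarith)
    have h2 : f' (y + 1) ≤ 0 := by
      refine ge_of_tendsto hlim ?_
      filter_upwards [eventually_gt_atTop (y + 1)] with z hz
      exact (hmono (show (0:ℝ) < y + 1 by linarith) (show 0 < z by linarith) hz).le
    linarith
  have hsq : ∀ y, 0 < y → f' y = -2 * (f y * √(f y)) := by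
    intro y hy
    have h1 := hpos y hy
    have h2 : (-f' y) ^ 2 = (2 * (f y * √(f y))) ^ 2 := by
      rw [neg_sq, hE y hy, mul_pow, mul_pow, Real.sq_sqrt h1.le]; ring
    have := (sq_eq_sq₀ (by linarith [hneg y hy]) (by positivity)).1 h2
    linarith
  have hc := hconst (fun y => (√(f y))⁻¹ - y) 0 (fun y hy => by
    have h1 := hpos y hy
    have h3 : 0 < √(f y) := Real.sqrt_pos.2 h1
    have := (((hf y hy).sqrt h1.ne').inv h3.ne').sub (hasDerivAt_id y)
    refine HasDerivAt.congr_deriv this ?_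
    rw [hsq y hy, Real.sq_sqrt h1.le]
    field_simp
    ring)
  refine ⟨(√(f 1))⁻¹ - 1, ?_, ?_⟩
  · have h := hle 1 one_pos
    have h3 : 0 < √(f 1) := Real.sqrt_pos.2 (hpos 1 one_pos)
    have : √(f 1) ≤ 1 := by
      rw [Real.sqrt_le_one]; simpa using h
    have := (one_le_inv₀ h3).2 this
    linarith
  · intro y hy
    have h : (√(f y))⁻¹ - y = (√(f 1))⁻¹ - 1 := hc y 1 hy one_pos
    have h1 := hpos y hy
    rw [← h]
    have : y + ((√(f y))⁻¹ - y) = (√(f y))⁻¹ := by ring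
    rw [this, inv_pow, Real.sq_sqrt h1.le]
    simp

lemma MM_solve {ψ : ℝ → ℝ} (hm : Measurable ψ) (h0 : ∀ X, 0 < ψ X) (h1 : ∀ X, ψ X ≤ 1)
    (hkey : ∀ l, 0 < l → MM ψ l (5/2) = (2 * π)⁻¹ *
      (3 * MM ψ l (3/2) * √(π / l) ^ 2 + 6 * MM ψ l (1/2) ^ 2 * √(π / l))) :
    ∃ c : ℝ, 0 ≤ c ∧ ∀ y, 0 < y → MM ψ (y ^ 2) (1/2) = √π / 2 / (y * (y + c) ^ 2) := by
  have hpi : 0 < √π := Real.sqrt_pos.2 Real.pi_pos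
  have hpi2 : √π * √π = π := Real.mul_self_sqrt Real.pi_pos.le
  have hG32 : Real.Gamma (3/2) = √π / 2 := by
    have : (3/2 : ℝ) = 1/2 + 1 := by norm_num
    rw [this, Real.Gamma_add_one (by norm_num), Real.Gamma_one_half_eq]; ring
  have hpw : ∀ y : ℝ, 0 < y → ∀ p q : ℝ, p * 2 = q → (1 / y ^ 2) ^ p = (y ^ q)⁻¹ := by
    intro y hy p q hpq
    rw [one_div, Real.inv_rpow (by positivity), ← Real.rpow_natCast y 2, ← Real.rpow_mul hy.le]
    congr 2
    rw [← hpq]; push_cast; ring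
  have hs : ∃ c : ℝ, 0 ≤ c ∧ ∀ y, 0 < y → 2 / √π * (y * MM ψ (y ^ 2) (1/2)) = 1 / (y + c) ^ 2 := by
    refine ode_solve (fun y => 2 / √π * (y * MM ψ (y ^ 2) (1/2)))
      (fun y => 2 / √π * (MM ψ (y ^ 2) (1/2) - 2 * (y ^ 2 * MM ψ (y ^ 2) (3/2)))) ?_ ?_ ?_ ?_ ?_
    · intro y hy
      have d1 := (MM_deriv hm h0 h1 (l := y ^ 2) (p := 1/2) (by positivity) (by norm_num)).comp y
        (hasDerivAt_pow 2 y)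
      have d2 := ((hasDerivAt_id y).mul d1).const_mul (2 / √π)
      refine HasDerivAt.congr_deriv d2 ?_
      norm_num
      left
      ring
    · intro y hy
      have d1 := (MM_deriv hm h0 h1 (l := y ^ 2) (p := 1/2) (by positivity) (by norm_num)).comp y
        (hasDerivAt_pow 2 y)
      have d3 := (MM_deriv hm h0 h1 (l := y ^ 2) (p := 3/2) (by positivity) (by norm_num)).comp y
        (hasDerivAt_pow 2 y)
      have d2 := (d1.sub (((hasDerivAt_pow 2 y).mul d3).const_mul 2)).const_mul (2 / √π)
      refine HasDerivAt.congr_deriv d2 ?_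
      have e1 : (1/2 : ℝ) + 1 = 3/2 := by norm_num
      have e2 : (3/2 : ℝ) + 1 = 5/2 := by norm_num
      have e3 : √(π / y ^ 2) = √π / y := by
        rw [Real.sqrt_div Real.pi_pos.le, Real.sqrt_sq hy.le]
      simp only [Function.comp, e1, e2, hkey (y ^ 2) (by positivity), e3]
      have e4 : (2 * π)⁻¹ = (2 * (√π * √π))⁻¹ := by rw [hpi2]
      rw [e4]
      field_simp
      ring
    · intro y hy
      have := MM_pos hm h0 h1 (l := y ^ 2) (p := 1/2) (by positivity) (by norm_num)
      positivity
    · intro y hy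
      have := MM_le hm h0 h1 (l := y ^ 2) (p := 1/2) (by positivity) (by norm_num)
      have e1 : (1/2 : ℝ) + 1 = 3/2 := by norm_num
      rw [e1, hG32, hpw y hy _ 3 (by norm_num)] at this
      have e : y ^ (3:ℝ) = y ^ 3 := by rw [← Real.rpow_natCast]; norm_num
      rw [e] at this
      calc 2 / √π * (y * MM ψ (y ^ 2) (1/2)) ≤ 2 / √π * (y * ((y ^ 3)⁻¹ * (√π / 2))) := by gcongr
        _ = 1 / y ^ 2 := by field_simp
    · set K := Real.Gamma (5/2)
      have hK : 0 < K := Real.Gamma_pos_of_pos (by norm_num)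
      refine squeeze_zero_norm' (a := fun y : ℝ => 2 / √π * ((√π / 2 + 2 * K) * (y ^ 3)⁻¹)) ?_ ?_
      · filter_upwards [eventually_gt_atTop 0] with y hy
        have b1 := MM_le hm h0 h1 (l := y ^ 2) (p := 1/2) (by positivity) (by norm_num)
        have b3 := MM_le hm h0 h1 (l := y ^ 2) (p := 3/2) (by positivity) (by norm_num)
        have p1 := MM_pos hm h0 h1 (l := y ^ 2) (p := 1/2) (by positivity) (by norm_num)
        have p3 := MM_pos hm h0 h1 (l := y ^ 2) (p := 3/2) (by positivity) (by norm_num)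
        have e1 : (1/2 : ℝ) + 1 = 3/2 := by norm_num
        have e2 : (3/2 : ℝ) + 1 = 5/2 := by norm_num
        rw [e1, hG32, hpw y hy _ 3 (by norm_num)] at b1
        rw [e2, hpw y hy _ 5 (by norm_num)] at b3
        have e : y ^ (3:ℝ) = y ^ 3 := by rw [← Real.rpow_natCast]; norm_num
        have e' : y ^ (5:ℝ) = y ^ 5 := by rw [← Real.rpow_natCast]; norm_num
        rw [e] at b1
        rw [e'] at b3
        rw [norm_mul, Real.norm_eq_abs, Real.norm_eq_abs, abs_of_pos (by positivity : 0 < 2 / √π)]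
        gcongr
        have b4 : y ^ 2 * MM ψ (y ^ 2) (3/2) ≤ (y ^ 3)⁻¹ * K := by
          calc _ ≤ y ^ 2 * ((y ^ 5)⁻¹ * K) := by gcongr
            _ = _ := by field_simp
        have p4 : 0 < y ^ 2 * MM ψ (y ^ 2) (3/2) := by positivity
        have p5 : 0 < (y ^ 3)⁻¹ := by positivity
        rw [abs_le]
        constructor
        · nlinarith
        · nlinarith
      · have : Tendsto (fun y : ℝ => (y ^ 3)⁻¹) atTop (𝓝 0) :=
          (tendsto_pow_atTop three_ne_zero).inv_tendsto_atTop
        have := (this.const_mul (√π / 2 + 2 * K)).const_mul (2 / √π)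
        simpa using this
  obtain ⟨c, hc, h⟩ := hs
  refine ⟨c, hc, fun y hy => ?_⟩
  have := h y hy
  have hyc : 0 < y + c := by linarith
  field_simp at this ⊢
  linarith

/-- The Laplace transform at `√X`. -/
noncomputable def psi (μ : Measure ℝ) (X : ℝ) : ℝ := (LL μ √X).toReal

lemma ae_nonneg_of {μ : Measure ℝ} (hs : μ (Iio 0) = 0) : ∀ᵐ d ∂μ, 0 ≤ d := by
  rw [ae_iff]
  simpa [Iio] using hs

lemma LL_le_one {μ : Measure ℝ} [IsProbabilityMeasure μ] (hs : μ (Iio 0) = 0) {t : ℝ}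
    (ht : 0 ≤ t) : LL μ t ≤ 1 := by
  have : LL μ t ≤ ∫⁻ _, 1 ∂μ := by
    refine lintegral_mono_ae ?_
    filter_upwards [ae_nonneg_of hs] with d hd
    rw [ENNReal.ofReal_le_one, Real.exp_le_one_iff]
    nlinarith
  simpa using this

lemma LL_pos {μ : Measure ℝ} [IsProbabilityMeasure μ] (t : ℝ) : 0 < LL μ t := by
  unfold LL
  rw [lintegral_pos_iff_support (by fun_prop)]
  have : Function.support (fun d : ℝ => ENNReal.ofReal (Real.exp (-(t * d)))) = univ := by
    ext d
    simp [Real.exp_pos]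
  rw [this]; simp

lemma psi_pos {μ : Measure ℝ} [IsProbabilityMeasure μ] (hs : μ (Iio 0) = 0) (X : ℝ) :
    0 < psi μ X :=
  ENNReal.toReal_pos (LL_pos _).ne' (ne_top_of_le_ne_top ENNReal.one_ne_top
    (LL_le_one hs (Real.sqrt_nonneg X)))

lemma psi_le_one {μ : Measure ℝ} [IsProbabilityMeasure μ] (hs : μ (Iio 0) = 0) (X : ℝ) :
    psi μ X ≤ 1 := by
  have := ENNReal.toReal_mono ENNReal.one_ne_top (LL_le_one hs (Real.sqrt_nonneg X))
  rwa [ENNReal.toReal_one] at this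

lemma measurable_psi (μ : Measure ℝ) [IsProbabilityMeasure μ] : Measurable (psi μ) :=
  ((measurable_LL μ).comp Real.continuous_sqrt.measurable).ennreal_toReal

lemma ofReal_psi {μ : Measure ℝ} [IsProbabilityMeasure μ] (hs : μ (Iio 0) = 0) (X : ℝ) :
    ENNReal.ofReal (psi μ X) = LL μ √X :=
  ENNReal.ofReal_toReal (ne_top_of_le_ne_top ENNReal.one_ne_top
    (LL_le_one hs (Real.sqrt_nonneg X)))

lemma psi_eq {μ : Measure ℝ} (X : ℝ) : psi μ X = ∫ d, Real.exp (-(√X * d)) ∂μ := by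
  rw [integral_eq_lintegral_of_nonneg_ae (Eventually.of_forall fun d => (Real.exp_pos _).le)
    (by fun_prop)]
  rfl

lemma continuous_psi {μ : Measure ℝ} [IsProbabilityMeasure μ] (hs : μ (Iio 0) = 0) :
    Continuous (psi μ) := by
  have : psi μ = fun X => ∫ d, Real.exp (-(√X * d)) ∂μ := funext psi_eq
  rw [this]
  refine continuous_of_dominated (bound := fun _ => 1) (fun X => by fun_prop) (fun X => ?_)
    (integrable_const _) (Eventually.of_forall fun d => by fun_prop)
  filter_upwards [ae_nonneg_of hs] with d hd
  rw [Real.norm_eq_abs, abs_of_pos (Real.exp_pos _), Real.exp_le_one_iff]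
  have := Real.sqrt_nonneg X
  nlinarith

lemma NN_eq {μ : Measure ℝ} [IsProbabilityMeasure μ] (hs : μ (Iio 0) = 0) {l p : ℝ}
    (hl : 0 < l) (hp : -1 < p) : NN μ l p = ENNReal.ofReal (MM (psi μ) l p) := by
  unfold MM NN
  rw [ofReal_integral_eq_lintegral_ofReal
    (MM_integrable (measurable_psi μ) (psi_pos hs) (psi_le_one hs) hl hp),
    ← lintegral_indicator measurableSet_Ioi]
  · refine lintegral_congr fun X => ?_
    by_cases h : 0 < X
    · rw [wp_pos h, Set.indicator_of_mem (show X ∈ Ioi (0:ℝ) from h),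
        ENNReal.ofReal_mul (p := X ^ p * Real.exp (-(l * X))) (by positivity), ofReal_psi hs]
    · rw [wp_nonpos h, Set.indicator_of_notMem (show X ∉ Ioi (0:ℝ) from h), zero_mul]
  · filter_upwards [ae_restrict_mem measurableSet_Ioi] with X hX
    have hX : 0 < X := hX
    have := psi_pos hs X
    show 0 ≤ X ^ p * Real.exp (-(l * X)) * psi μ X
    positivity

lemma BB_eq {l : ℝ} (hl : 0 < l) : BB l = ENNReal.ofReal √(π / l) := by
  have h1 := gam_integral (p := -(1/2)) hl (by norm_num)
  have h2 : (1 / l) ^ (-(1/2) + 1 : ℝ) * Real.Gamma (-(1/2) + 1) = √(π / l) := by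
    have e : (-(1/2) + 1 : ℝ) = 1/2 := by norm_num
    rw [e, Real.Gamma_one_half_eq, ← Real.sqrt_eq_rpow, ← Real.sqrt_mul (by positivity)]
    congr 1
    ring
  rw [← h2, ← h1, ofReal_integral_eq_lintegral_ofReal (gam_integrable hl (by norm_num)),
    ← lintegral_indicator measurableSet_Ioi]
  · rfl
  · filter_upwards [ae_restrict_mem measurableSet_Ioi] with X hX
    have hX : 0 < X := hX
    show 0 ≤ X ^ (-(1/2) : ℝ) * Real.exp (-(l * X))
    positivity

lemma fixed_MM {μ : Measure ℝ} [IsProbabilityMeasure μ] (hs : μ (Iio 0) = 0)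
    (hfix : Fsm μ = μ) :
    ∃ c : ℝ, 0 ≤ c ∧ ∀ y, 0 < y → MM (psi μ) (y ^ 2) (1/2) = √π / 2 / (y * (y + c) ^ 2) := by
  refine MM_solve (measurable_psi μ) (psi_pos hs) (psi_le_one hs) fun l hl => ?_
  have h := NN_key μ hfix l
  have P : ∀ {p : ℝ}, -1 < p → 0 < MM (psi μ) l p := fun hp =>
    MM_pos (measurable_psi μ) (psi_pos hs) (psi_le_one hs) hl hp
  have p1 := P (p := 1/2) (by norm_num)
  have p3 := P (p := 3/2) (by norm_num)
  rw [NN_eq hs hl (by norm_num), NN_eq hs hl (by norm_num), NN_eq hs hl (by norm_num), BB_eq hl] at h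
  have h' := congrArg ENNReal.toReal h
  rw [ENNReal.toReal_ofReal (P (by norm_num)).le] at h'
  rw [h', ENNReal.toReal_mul, ENNReal.toReal_ofReal (by positivity), ENNReal.toReal_add]
  · simp only [ENNReal.toReal_mul, ENNReal.toReal_pow, ENNReal.toReal_ofReal p1.le,
      ENNReal.toReal_ofReal p3.le, ENNReal.toReal_ofReal (Real.sqrt_nonneg _),
      ENNReal.toReal_ofNat]
  · exact (ENNReal.mul_lt_top (ENNReal.mul_lt_top (by simp) (by simp)) (by simp)).ne
  · exact (ENNReal.mul_lt_top (ENNReal.mul_lt_top (by simp) (by simp)) (by simp)).ne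

lemma laplace_unique {μ ν : Measure ℝ} [IsFiniteMeasure μ] [IsFiniteMeasure ν]
    (hμ : μ (Iio 0) = 0) (hν : ν (Iio 0) = 0)
    (h : ∀ n : ℕ, ∫ d, Real.exp (-(n * d)) ∂μ = ∫ d, Real.exp (-(n * d)) ∂ν) : μ = ν := by
  let X : ℝ → ℝ := fun d => Real.exp (-d)
  have hX : Measurable X := by fun_prop
  have hae : ∀ {μ : Measure ℝ}, μ (Iio 0) = 0 → ∀ᵐ d ∂μ, |X d| ≤ 1 := by
    intro μ hμ
    have : ∀ᵐ d ∂μ, 0 ≤ d := by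
      rw [ae_iff]; simpa [Iio] using hμ
    filter_upwards [this] with d hd
    rw [abs_of_pos (Real.exp_pos _)]
    exact Real.exp_le_one_iff.2 (by linarith)
  have hmgf : ∀ {μ : Measure ℝ} [IsFiniteMeasure μ], μ (Iio 0) = 0 → ∀ s : ℝ,
      HasSum (fun n : ℕ => s ^ n / n.factorial * ∫ d, Real.exp (-(n * d)) ∂μ)
        (ProbabilityTheory.mgf X μ s) := by
    intro μ _ hμ s
    have key := hasSum_integral_of_dominated_convergence (μ := μ)
      (F := fun (n : ℕ) d => s ^ n / n.factorial * Real.exp (-(n * d)))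
      (f := fun d => Real.exp (s * X d))
      (fun n _ => |s| ^ n / n.factorial) (fun n => by fun_prop) (fun n => ?_)
      (Eventually.of_forall fun _ => Real.summable_pow_div_factorial _) (integrable_const _)
      (Eventually.of_forall fun d => ?_)
    · simp only [integral_const_mul] at key
      exact key
    · filter_upwards [hae hμ] with d hd
      have e : Real.exp (-(n * d)) = X d ^ n := by
        show _ = Real.exp (-d) ^ n
        rw [← Real.exp_nat_mul]; congr 1; ring
      rw [e, norm_mul, norm_div, norm_pow, norm_pow]
      simp only [Real.norm_eq_abs, Nat.abs_cast]
      exact mul_le_of_le_one_right (by positivity) (pow_le_one₀ (abs_nonneg _) hd)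
    · have e : ∀ n : ℕ, s ^ n / n.factorial * Real.exp (-(n * d)) = (s * X d) ^ n / n.factorial := by
        intro n
        have e : Real.exp (-(n * d)) = X d ^ n := by
          show _ = Real.exp (-d) ^ n
          rw [← Real.exp_nat_mul]; congr 1; ring
        rw [e, mul_pow]; ring
      simp only [e]
      rw [Real.exp_eq_exp_ℝ]
      exact NormedSpace.expSeries_div_hasSum_exp (s * X d)
  have hm : ProbabilityTheory.mgf X μ = ProbabilityTheory.mgf X ν := by
    funext s
    refine (hmgf hμ s).unique ?_
    simp only [h]
    exact hmgf hν s
  have h0 : μ = 0 ↔ ν = 0 := by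
    have := h 0
    simp at this
    rw [← Measure.measure_univ_eq_zero, ← Measure.measure_univ_eq_zero]
    simp only [Measure.real] at this
    rw [ENNReal.toReal_eq_toReal_iff' (measure_ne_top _ _) (measure_ne_top _ _)] at this
    rw [this]
  have hInt : ProbabilityTheory.integrableExpSet X μ = univ := by
    ext s
    simp only [ProbabilityTheory.integrableExpSet, Set.mem_ofPred_eq, mem_univ, iff_true]
    refine Integrable.mono' (integrable_const (Real.exp |s|)) (by fun_prop) ?_
    filter_upwards [hae hμ] with d hd
    rw [Real.norm_eq_abs, abs_of_pos (Real.exp_pos _), Real.exp_le_exp]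
    refine (le_abs_self _).trans ?_
    rw [abs_mul]
    exact mul_le_of_le_one_right (abs_nonneg _) hd
  have hc : ProbabilityTheory.complexMGF X μ = ProbabilityTheory.complexMGF X ν := by
    funext z
    have := ProbabilityTheory.eqOn_complexMGF_of_mgf' hm h0
    exact this (by simp [hInt])
  have hmap := Measure.ext_of_complexMGF_eq hX.aemeasurable hX.aemeasurable hc
  have hinv : ∀ μ : Measure ℝ, (μ.map X).map (fun x => -Real.log x) = μ := by
    intro μ
    rw [Measure.map_map (by fun_prop) hX]
    have : (fun x => -Real.log x) ∘ X = id := by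
      funext d; simp [X]
    rw [this, Measure.map_id]
  rw [← hinv μ, ← hinv ν, hmap]

lemma MM_unique {f g : ℝ → ℝ} (hf : Continuous f) (f0 : ∀ X, 0 < f X) (f1 : ∀ X, f X ≤ 1)
    (hg : Continuous g) (g0 : ∀ X, 0 < g X) (g1 : ∀ X, g X ≤ 1)
    (h : ∀ l, 1 ≤ l → MM f l (1/2) = MM g l (1/2)) {X : ℝ} (hX : 0 < X) : f X = g X := by
  let w : (ℝ → ℝ) → ℝ → ℝ := fun f X => X ^ (1/2 : ℝ) * Real.exp (-(1 * X)) * f X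
  let ρ : (ℝ → ℝ) → Measure ℝ := fun f =>
    (volume.restrict (Ioi (0:ℝ))).withDensity (fun X => ENNReal.ofReal (w f X))
  have hwm : ∀ f : ℝ → ℝ, Continuous f → Measurable (w f) := by
    intro f hf
    have := hf.measurable
    fun_prop
  have hfin : ∀ f : ℝ → ℝ, Continuous f → (∀ X, 0 < f X) → (∀ X, f X ≤ 1) →
      Integrable (w f) (volume.restrict (Ioi (0:ℝ))) := fun f hf f0 f1 =>
    MM_integrable hf.measurable f0 f1 one_pos (by norm_num)
  have hsupp : ∀ f : ℝ → ℝ, ρ f (Iio 0) = 0 := by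
    intro f
    refine withDensity_absolutelyContinuous _ _ ?_
    rw [Measure.restrict_apply measurableSet_Iio]
    have : Iio (0:ℝ) ∩ Ioi 0 = ∅ := by ext x; simp; intro h; exact h.le
    rw [this]; simp
  have hInt : ∀ f : ℝ → ℝ, Continuous f → (∀ X, 0 < f X) → ∀ n : ℕ,
      ∫ d, Real.exp (-(n * d)) ∂(ρ f) = MM f (1 + n) (1/2) := by
    intro f hf f0 n
    show ∫ d, Real.exp (-(n * d)) ∂((volume.restrict (Ioi (0:ℝ))).withDensity
      (fun X => ENNReal.ofReal (w f X))) = _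
    rw [integral_withDensity_eq_integral_toReal_smul (hwm f hf).ennreal_ofReal
      (Eventually.of_forall fun _ => ENNReal.ofReal_lt_top)]
    unfold MM
    refine setIntegral_congr_fun measurableSet_Ioi fun X hX => ?_
    have hX : 0 < X := hX
    have h2 := f0 X
    have : 0 ≤ w f X := by
      show 0 ≤ X ^ (1/2 : ℝ) * Real.exp (-(1 * X)) * f X
      positivity
    simp only [ENNReal.toReal_ofReal this, smul_eq_mul]
    show X ^ (1/2 : ℝ) * Real.exp (-(1 * X)) * f X * Real.exp (-(n * X)) = _
    have e : Real.exp (-((1 + n) * X)) = Real.exp (-(1 * X)) * Real.exp (-(n * X)) := by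
      rw [← Real.exp_add]; congr 1; ring
    rw [e]; ring
  have := isFiniteMeasure_withDensity_ofReal (hfin f hf f0 f1).2
  have := isFiniteMeasure_withDensity_ofReal (hfin g hg g0 g1).2
  have heq : ρ f = ρ g := by
    refine laplace_unique (hsupp f) (hsupp g) fun n => ?_
    rw [hInt f hf f0, hInt g hg g0]
    exact h _ (by linarith [(Nat.cast_nonneg n : (0:ℝ) ≤ n)])
  have hae := (withDensity_eq_iff (hwm f hf).ennreal_ofReal.aemeasurable
    (hwm g hg).ennreal_ofReal.aemeasurable (hfin f hf f0 f1).lintegral_lt_top.ne).1 heq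
  have hae2 : f =ᵐ[volume.restrict (Ioi (0:ℝ))] g := by
    filter_upwards [hae, ae_restrict_mem measurableSet_Ioi] with X hX hX0
    have hX0 : 0 < X := hX0
    have a1 := f0 X
    have a2 := g0 X
    have hp : 0 < X ^ (1/2 : ℝ) * Real.exp (-(1 * X)) := by positivity
    have := (ENNReal.ofReal_eq_ofReal_iff (p := X ^ (1/2 : ℝ) * Real.exp (-(1 * X)) * f X)
      (q := X ^ (1/2 : ℝ) * Real.exp (-(1 * X)) * g X) (by positivity) (by positivity)).1 hX
    exact mul_left_cancel₀ hp.ne' this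
  exact Measure.eqOn_open_of_ae_eq hae2 isOpen_Ioi hf.continuousOn hg.continuousOn hX

lemma measure_unique {μ ν : Measure ℝ} [IsProbabilityMeasure μ] [IsProbabilityMeasure ν]
    (hμ : μ (Iio 0) = 0) (hν : ν (Iio 0) = 0)
    (h : ∀ y, 1 ≤ y → MM (psi μ) (y ^ 2) (1/2) = MM (psi ν) (y ^ 2) (1/2)) : μ = ν := by
  refine laplace_unique hμ hν fun n => ?_
  rcases Nat.eq_zero_or_pos n with rfl | hn
  · simp
  have hn' : (0:ℝ) < n := by exact_mod_cast hn
  have := MM_unique (continuous_psi hμ) (psi_pos hμ) (psi_le_one hμ)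
    (continuous_psi hν) (psi_pos hν) (psi_le_one hν) (X := (n:ℝ) ^ 2) (fun l hl => by
      have := h √l (Real.one_le_sqrt.2 hl)
      rwa [Real.sq_sqrt (by linarith)] at this) (by positivity)
  rwa [psi_eq, psi_eq, Real.sqrt_sq hn'.le] at this

/-- Density factor of the scaled Rayleigh computation. -/
noncomputable def rg (l : ℝ) (q : ℝ × ℝ) : ENNReal :=
  ({q : ℝ × ℝ | 0 < q.1 ∧ 0 < q.2}).indicator (fun q => ENNReal.ofReal
    (q.2 * (q.1 ^ (3/2 : ℝ) * Real.exp (-((l + q.2 + q.2 ^ 2 / 2) * q.1))))) q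

lemma measurable_rg (l : ℝ) : Measurable (rg l) := by
  refine Measurable.indicator (by fun_prop) ?_
  exact (measurableSet_lt measurable_const measurable_fst).inter
    (measurableSet_lt measurable_const measurable_snd)

lemma LL_rayleigh (t : ℝ) (ht : 0 < t) : LL rayleigh t =
    ∫⁻ s, (Ioi (0:ℝ)).indicator (fun s => ENNReal.ofReal
      (t ^ 2 * s * Real.exp (-(t ^ 2 * (s + s ^ 2 / 2))))) s := by
  unfold LL rayleigh
  have hm : Measurable (fun x : ℝ => ENNReal.ofReal
      (Set.indicator (Set.Ioi (0 : ℝ)) (fun y => y * Real.exp (-y ^ 2 / 2)) x)) :=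
    (Measurable.indicator (by fun_prop) measurableSet_Ioi).ennreal_ofReal
  rw [lintegral_withDensity_eq_lintegral_mul _ hm (by fun_prop),
    lintegral_scale _ (hm.mul (by fun_prop)) (inv_pos.2 ht)]
  refine lintegral_congr fun s => ?_
  simp only [inv_inv, Pi.mul_apply]
  by_cases hs : 0 < s
  · have h1 : s * t ∈ Ioi (0:ℝ) := mul_pos hs ht
    rw [Set.indicator_of_mem h1, Set.indicator_of_mem (show s ∈ Ioi (0:ℝ) from hs),
      ← ENNReal.ofReal_mul (by positivity), ← ENNReal.ofReal_mul (by positivity)]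
    congr 1
    have e : Real.exp (-(t ^ 2 * (s + s ^ 2 / 2))) =
        Real.exp (-(s * t) ^ 2 / 2) * Real.exp (-(t * (s * t))) := by
      rw [← Real.exp_add]; congr 1; ring
    rw [e]; ring
  · have h1 : s * t ∉ Ioi (0:ℝ) := by
      intro h
      exact hs (pos_of_mul_pos_left h ht.le)
    rw [Set.indicator_of_notMem h1, Set.indicator_of_notMem (show s ∉ Ioi (0:ℝ) from hs)]
    simp

lemma NN_rayleigh (l : ℝ) (hl : 0 < l) : NN rayleigh l (1/2) =
    ∫⁻ s in Ioi (0:ℝ), ENNReal.ofReal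
      (s * ((1 / (l + s + s ^ 2 / 2)) ^ (5/2 : ℝ) * Real.Gamma (5/2))) := by
  have h1 : NN rayleigh l (1/2) = ∫⁻ X, ∫⁻ s, rg l (X, s) := by
    refine lintegral_congr fun X => ?_
    by_cases hX : 0 < X
    · rw [wp_pos hX, LL_rayleigh _ (Real.sqrt_pos.2 hX), ← lintegral_const_mul _
        (Measurable.indicator (by fun_prop) measurableSet_Ioi)]
      refine lintegral_congr fun s => ?_
      by_cases hs : 0 < s
      · rw [Set.indicator_of_mem (show s ∈ Ioi (0:ℝ) from hs), rg,
          Set.indicator_of_mem (show (X, s) ∈ {q : ℝ × ℝ | 0 < q.1 ∧ 0 < q.2} from ⟨hX, hs⟩),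
          ← ENNReal.ofReal_mul (by positivity), Real.sq_sqrt hX.le]
        congr 1
        have e1 : X ^ (3/2 : ℝ) = X ^ (1/2 : ℝ) * X := by
          nth_rewrite 3 [← Real.rpow_one X]
          rw [← Real.rpow_add hX]; norm_num
        have e2 : Real.exp (-((l + s + s ^ 2 / 2) * X)) =
            Real.exp (-(l * X)) * Real.exp (-(X * (s + s ^ 2 / 2))) := by
          rw [← Real.exp_add]; congr 1; ring
        simp only
        rw [e1, e2]; ring
      · rw [Set.indicator_of_notMem (show s ∉ Ioi (0:ℝ) from hs), rg,
          Set.indicator_of_notMem (show (X, s) ∉ {q : ℝ × ℝ | 0 < q.1 ∧ 0 < q.2} from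
            fun h => hs h.2), mul_zero]
    · rw [wp_nonpos hX, zero_mul]
      symm
      rw [← lintegral_zero (α := ℝ) (μ := volume)]
      refine lintegral_congr fun s => ?_
      rw [rg, Set.indicator_of_notMem (show (X, s) ∉ {q : ℝ × ℝ | 0 < q.1 ∧ 0 < q.2} from
            fun h => hX h.1)]
  rw [h1, lintegral_lintegral_swap (f := fun X s => rg l (X, s)) (measurable_rg l).aemeasurable,
    ← lintegral_indicator measurableSet_Ioi]
  refine lintegral_congr fun s => ?_
  by_cases hs : 0 < s
  · rw [Set.indicator_of_mem (show s ∈ Ioi (0:ℝ) from hs)]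
    have hQ : 0 < l + s + s ^ 2 / 2 := by positivity
    have e : (3/2 + 1 : ℝ) = 5/2 := by norm_num
    have hG := gam_integral (p := 3/2) hQ (by norm_num)
    rw [e] at hG
    rw [← hG, ENNReal.ofReal_mul hs.le, ofReal_integral_eq_lintegral_ofReal
      (gam_integrable hQ (by norm_num)), ← lintegral_const_mul _ (by fun_prop),
      ← lintegral_indicator measurableSet_Ioi]
    · refine lintegral_congr fun X => ?_
      by_cases hX : 0 < X
      · rw [rg, Set.indicator_of_mem (show (X, s) ∈ {q : ℝ × ℝ | 0 < q.1 ∧ 0 < q.2} from ⟨hX, hs⟩),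
          Set.indicator_of_mem (show X ∈ Ioi (0:ℝ) from hX), ← ENNReal.ofReal_mul hs.le]
      · rw [rg, Set.indicator_of_notMem (show (X, s) ∉ {q : ℝ × ℝ | 0 < q.1 ∧ 0 < q.2} from
            fun h => hX h.1), Set.indicator_of_notMem (show X ∉ Ioi (0:ℝ) from hX)]
    · filter_upwards [ae_restrict_mem measurableSet_Ioi] with X hX
      have hX : 0 < X := hX
      show 0 ≤ X ^ (3/2 : ℝ) * Real.exp (-((l + s + s ^ 2 / 2) * X))
      positivity
  · rw [Set.indicator_of_notMem (show s ∉ Ioi (0:ℝ) from hs)]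
    rw [← lintegral_zero (α := ℝ) (μ := volume)]
    refine lintegral_congr fun X => ?_
    rw [rg, Set.indicator_of_notMem (show (X, s) ∉ {q : ℝ × ℝ | 0 < q.1 ∧ 0 < q.2} from
          fun h => hs h.2)]

lemma rayleigh_supp : rayleigh (Iio 0) = 0 := by
  unfold rayleigh
  rw [withDensity_apply _ measurableSet_Iio]
  rw [setLIntegral_eq_zero measurableSet_Iio]
  intro x hx
  have hx : x < 0 := hx
  simp [Set.indicator, not_lt.2 hx.le]

instance rayleigh_prob : IsProbabilityMeasure rayleigh := by
  constructor
  unfold rayleigh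
  rw [withDensity_apply _ MeasurableSet.univ, Measure.restrict_univ]
  have hd : ∀ x ∈ Ici (0:ℝ), HasDerivAt (fun x : ℝ => -Real.exp (-x ^ 2 / 2))
      (x * Real.exp (-x ^ 2 / 2)) x := by
    intro x _
    have h := (((hasDerivAt_pow 2 x).neg.div_const 2).exp).neg
    refine HasDerivAt.congr_deriv h ?_
    simp only [Pi.neg_apply]
    push_cast
    ring
  have hpos : ∀ x ∈ Ioi (0:ℝ), 0 ≤ x * Real.exp (-x ^ 2 / 2) := by
    intro x hx
    have hx : 0 < x := hx
    positivity
  have hlim : Tendsto (fun x : ℝ => -Real.exp (-x ^ 2 / 2)) atTop (𝓝 0) := by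
    rw [← neg_zero]
    refine Tendsto.neg ?_
    refine Real.tendsto_exp_atBot.comp ?_
    have : Tendsto (fun x : ℝ => x ^ 2 / 2) atTop atTop :=
      (tendsto_pow_atTop two_ne_zero).atTop_div_const (by norm_num)
    have := tendsto_neg_atTop_atBot.comp this
    refine this.congr fun x => ?_
    simp only [Function.comp]
    ring
  have hInt := integral_Ioi_of_hasDerivAt_of_nonneg' hd hpos hlim
  have hii := integrableOn_Ioi_deriv_of_nonneg' hd hpos hlim
  have : ∫⁻ x, ENNReal.ofReal
      (Set.indicator (Set.Ioi (0 : ℝ)) (fun y => y * Real.exp (-y ^ 2 / 2)) x) =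
      ∫⁻ x in Ioi (0:ℝ), ENNReal.ofReal (x * Real.exp (-x ^ 2 / 2)) := by
    rw [← lintegral_indicator measurableSet_Ioi]
    refine lintegral_congr fun x => ?_
    by_cases hx : x ∈ Ioi (0:ℝ)
    · simp only [Set.indicator_of_mem hx]
    · simp only [Set.indicator_of_notMem hx, ENNReal.ofReal_zero]
  rw [this, ← ofReal_integral_eq_lintegral_ofReal hii, hInt]
  · simp
  · filter_upwards [ae_restrict_mem measurableSet_Ioi] with x hx using hpos x hx

lemma ray_int {l : ℝ} (hl : 1 ≤ l) :
    IntegrableOn (fun s : ℝ => (s * (√2 / √((s + 1) ^ 2 + (2 * l - 1))) ^ 5)) (Ioi 0) ∧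
    ∫ s in Ioi (0:ℝ), (s * (√2 / √((s + 1) ^ 2 + (2 * l - 1))) ^ 5) =
      √2 ^ 5 / (3 * √(2 * l) * (√(2 * l) + 1) ^ 2) := by
  set k := 2 * l - 1 with hk
  have hk0 : 0 < k := by linarith
  let R : ℝ → ℝ := fun s => √((s + 1) ^ 2 + k)
  have hR : ∀ s, 0 < R s := fun s => Real.sqrt_pos.2 (by positivity)
  have hR2 : ∀ s, R s ^ 2 = (s + 1) ^ 2 + k := fun s => Real.sq_sqrt (by positivity)
  have hRd : ∀ s, HasDerivAt R ((s + 1) / R s) s := by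
    intro s
    have h1 : HasDerivAt (fun s : ℝ => (s + 1) ^ 2 + k) (2 * (s + 1)) s := by
      have := (((hasDerivAt_id s).add_const (1:ℝ)).pow 2).add_const k
      refine HasDerivAt.congr_deriv this ?_
      simp
    refine HasDerivAt.congr_deriv (h1.sqrt (by positivity)) ?_
    show 2 * (s + 1) / (2 * R s) = _
    rw [mul_div_mul_left _ _ two_ne_zero]
  let G : ℝ → ℝ := fun s => √2 ^ 5 * (-(1 / 3) * (R s)⁻¹ ^ 3 - 1 / (3 * k) * ((s + 1) * (R s)⁻¹ ^ 3)
    + 2 / (3 * k ^ 2) * (1 - (s + 1) * (R s)⁻¹))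
  have hd : ∀ s ∈ Ici (0:ℝ), HasDerivAt G (s * (√2 / R s) ^ 5) s := by
    intro s _
    have hR0 := hR s
    have hi : HasDerivAt (fun s => (R s)⁻¹) (-((s + 1) / R s) / R s ^ 2) s :=
      (hRd s).inv hR0.ne'
    have hw : HasDerivAt (fun s : ℝ => s + 1) 1 s := (hasDerivAt_id s).add_const (1:ℝ)
    have h := (((hi.pow 3).const_mul (-(1 / 3) : ℝ)).sub ((hw.mul (hi.pow 3)).const_mul (1 / (3 * k)))
      |>.add (((hw.mul hi).const_sub 1).const_mul (2 / (3 * k ^ 2)))).const_mul (√2 ^ 5)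
    refine HasDerivAt.congr_deriv h ?_
    simp only [Pi.pow_apply]
    have h2 := hR2 s
    have hke : k = R s ^ 2 - (s + 1) ^ 2 := by linarith
    generalize R s = r at *
    generalize √2 = a at *
    push_cast
    have hk1 : r ^ 2 - (s + 1) ^ 2 ≠ 0 := by rw [← hke]; exact hk0.ne'
    clear_value k
    subst hke
    field_simp
    ring
  have hpos : ∀ s ∈ Ioi (0:ℝ), 0 ≤ s * (√2 / R s) ^ 5 := by
    intro s hs
    have hs : 0 < s := hs
    have := hR s
    positivity
  have hRinf : Tendsto R atTop atTop := by
    refine tendsto_atTop_mono' atTop (f₁ := fun s : ℝ => s) ?_ tendsto_id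
    filter_upwards [eventually_ge_atTop 0] with s hs
    refine Real.le_sqrt_of_sq_le ?_
    nlinarith
  have hRi : Tendsto (fun s => (R s)⁻¹) atTop (𝓝 0) := hRinf.inv_tendsto_atTop
  have hwR : Tendsto (fun s => (s + 1) * (R s)⁻¹) atTop (𝓝 1) := by
    have h1 : Tendsto (fun s => √(1 - k * (R s)⁻¹ ^ 2)) atTop (𝓝 1) := by
      have := ((hRi.pow 2).const_mul k).const_sub 1
      have := this.sqrt
      simpa using this
    refine h1.congr' ?_
    filter_upwards [eventually_gt_atTop 0] with s hs
    have hR0 := hR s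
    have h2 := hR2 s
    rw [Real.sqrt_eq_iff_mul_self_eq_of_pos (by positivity)]
    field_simp
    linarith
  have hlim : Tendsto G atTop (𝓝 0) := by
    have h3 : Tendsto (fun s => (s + 1) * (R s)⁻¹ ^ 3) atTop (𝓝 0) := by
      have := hwR.mul (hRi.pow 2)
      simp only [ne_eq, OfNat.ofNat_ne_zero, not_false_eq_true, zero_pow, mul_zero] at this
      refine this.congr fun s => ?_
      ring
    have := ((((hRi.pow 3).const_mul (-(1/3) : ℝ)).sub (h3.const_mul (1 / (3 * k)))).add
      ((hwR.const_sub 1).const_mul (2 / (3 * k ^ 2)))).const_mul (√2 ^ 5)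
    simpa [G] using this
  refine ⟨integrableOn_Ioi_deriv_of_nonneg' hd hpos hlim, ?_⟩
  have := integral_Ioi_of_hasDerivAt_of_nonneg' hd hpos hlim
  refine this.trans ?_
  have hR0 : R 0 = √(2 * l) := by
    show √((0 + 1) ^ 2 + k) = _
    rw [hk]; congr 1; ring
  have hz : 0 < √(2 * l) := Real.sqrt_pos.2 (by linarith)
  have hz2 : √(2 * l) ^ 2 = 2 * l := Real.sq_sqrt (by linarith)
  have hz1 : 1 < √(2 * l) := Real.lt_sqrt_of_sq_lt (by linarith)
  simp only [G, hR0]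
  have hke : k = √(2 * l) ^ 2 - 1 := by rw [hz2]
  have hk' : k = (√(2 * l) - 1) * (√(2 * l) + 1) := by rw [hke]; ring
  rw [hk']
  generalize √(2 * l) = z at *
  generalize √2 = a at *
  have : z - 1 ≠ 0 := by linarith
  have : z + 1 ≠ 0 := by linarith
  field_simp
  ring

lemma MM_rayleigh {y : ℝ} (hy : 1 ≤ y) :
    MM (psi rayleigh) (y ^ 2) (1/2) = √π / 2 / (y * (y + (√2)⁻¹) ^ 2) := by
  have hl : 1 ≤ y ^ 2 := one_le_pow₀ hy
  have hl0 : 0 < y ^ 2 := by linarith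
  have hN := NN_rayleigh (y ^ 2) hl0
  have h2 : 0 < √2 := Real.sqrt_pos.2 (by norm_num)
  have h22 : √2 ^ 2 = 2 := Real.sq_sqrt (by norm_num)
  have hG : Real.Gamma (5/2) = 3 / 4 * √π := by
    have e : (5/2 : ℝ) = 1/2 + 1 + 1 := by norm_num
    rw [e, Real.Gamma_add_one (by norm_num), Real.Gamma_add_one (by norm_num),
      Real.Gamma_one_half_eq]; ring
  obtain ⟨hi, hI⟩ := ray_int hl
  have hpi : 0 < √π := Real.sqrt_pos.2 Real.pi_pos
  have hEq : ∀ s ∈ Ioi (0:ℝ), ENNReal.ofReal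
      (s * ((1 / (y ^ 2 + s + s ^ 2 / 2)) ^ (5/2 : ℝ) * Real.Gamma (5/2))) = ENNReal.ofReal
      (s * (√2 / √((s + 1) ^ 2 + (2 * y ^ 2 - 1))) ^ 5 * (3 / 4 * √π)) := by
    intro s hs
    have hs : 0 < s := hs
    have hk : 0 < (s + 1) ^ 2 + (2 * y ^ 2 - 1) := by nlinarith
    have hr := Real.sqrt_pos.2 hk
    have hr2 := Real.sq_sqrt hk.le
    have e : 1 / (y ^ 2 + s + s ^ 2 / 2) = (√2 / √((s + 1) ^ 2 + (2 * y ^ 2 - 1))) ^ (2:ℝ) := by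
      rw [Real.rpow_ofNat, div_pow, h22, hr2]
      have : 0 < y ^ 2 + s + s ^ 2 / 2 := by positivity
      rw [div_eq_div_iff this.ne' hk.ne']
      ring
    rw [hG, e, ← Real.rpow_mul (by positivity)]
    have e5 : (2 * (5/2) : ℝ) = (5 : ℕ) := by norm_num
    rw [e5, Real.rpow_natCast]
    congr 1
    ring
  rw [setLIntegral_congr_fun measurableSet_Ioi hEq, ← ofReal_integral_eq_lintegral_ofReal
    (hi.mul_const _), integral_mul_const, hI, NN_eq rayleigh_supp hl0 (by norm_num)] at hN
  · rw [ENNReal.ofReal_eq_ofReal_iff (MM_pos (measurable_psi _) (psi_pos rayleigh_supp)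
      (psi_le_one rayleigh_supp) hl0 (by norm_num)).le (by positivity)] at hN
    rw [hN, Real.sqrt_mul (by norm_num), Real.sqrt_sq (by linarith)]
    have hy0 : 0 < y := by linarith
    have e5 : √2 ^ 5 = 4 * √2 := by
      have : √2 ^ 5 = (√2 ^ 2) ^ 2 * √2 := by ring
      rw [this, h22]; ring
    have e6 : (√2 * y + 1) ^ 2 = 2 * (y + (√2)⁻¹) ^ 2 := by
      have : √2 * y + 1 = √2 * (y + (√2)⁻¹) := by field_simp
      rw [this, mul_pow, h22]
    rw [e5, e6]
    have : 0 < y + (√2)⁻¹ := by positivity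
    generalize y + (√2)⁻¹ = a at *
    field_simp
  · filter_upwards [ae_restrict_mem measurableSet_Ioi] with s hs
    have hs : 0 < s := hs
    show 0 ≤ s * (√2 / √((s + 1) ^ 2 + (2 * y ^ 2 - 1))) ^ 5 * (3 / 4 * √π)
    positivity

lemma psi_dirac (X : ℝ) : psi (Measure.dirac 0) X = 1 := by
  rw [psi_eq]; simp

lemma MM_dirac {y : ℝ} (hy : 0 < y) :
    MM (psi (Measure.dirac 0)) (y ^ 2) (1/2) = √π / 2 / (y * (y + 0) ^ 2) := by
  unfold MM
  simp only [psi_dirac, mul_one]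
  have e : (1/2 + 1 : ℝ) = 3/2 := by norm_num
  have hG32 : Real.Gamma (3/2) = √π / 2 := by
    rw [← e, Real.Gamma_add_one (by norm_num), Real.Gamma_one_half_eq]; ring
  rw [gam_integral (by positivity) (by norm_num), e, hG32]
  have e1 : (1 / y ^ 2 : ℝ) = (1 / y) ^ (2:ℝ) := by rw [Real.rpow_ofNat]; ring
  have e2 : (2 * (3/2) : ℝ) = (3 : ℕ) := by norm_num
  rw [e1, ← Real.rpow_mul (by positivity), e2, Real.rpow_natCast]
  field_simp
  ring

lemma psi_map {μ : Measure ℝ} {α : ℝ} (hα : 0 < α) (X : ℝ) :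
    psi (Measure.map (fun x => α * x) μ) X = psi μ (α ^ 2 * X) := by
  rw [psi_eq, psi_eq, integral_map (by fun_prop) (by fun_prop), Real.sqrt_mul (by positivity),
    Real.sqrt_sq hα.le]
  refine integral_congr_ae (Eventually.of_forall fun d => ?_)
  simp only
  congr 1
  ring

lemma MM_map {μ : Measure ℝ} {α : ℝ} (hα : 0 < α) (y : ℝ) :
    MM (psi (Measure.map (fun x => α * x) μ)) (y ^ 2) (1/2) =
      (α ^ 3)⁻¹ * MM (psi μ) ((y / α) ^ 2) (1/2) := by
  have h := integral_comp_mul_left_Ioi (fun x : ℝ => α⁻¹ *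
    (x ^ (1/2 : ℝ) * Real.exp (-((y / α) ^ 2 * x)) * psi μ x)) 0 (b := α ^ 2) (by positivity)
  rw [mul_zero, smul_eq_mul] at h
  have h2 : (α ^ 3)⁻¹ * MM (psi μ) ((y / α) ^ 2) (1/2) =
      (α ^ 2)⁻¹ * ∫ x in Ioi (0:ℝ), α⁻¹ *
        (x ^ (1/2 : ℝ) * Real.exp (-((y / α) ^ 2 * x)) * psi μ x) := by
    rw [integral_const_mul, MM, pow_succ α 2, mul_inv, mul_assoc]
  rw [h2]
  refine Eq.trans ?_ h
  unfold MM
  refine setIntegral_congr_fun measurableSet_Ioi fun X hX => ?_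
  have hX : 0 < X := hX
  simp only [psi_map hα]
  have e : (α ^ 2 * X) ^ (1/2 : ℝ) = α * X ^ (1/2 : ℝ) := by
    rw [Real.mul_rpow (by positivity) hX.le, ← Real.sqrt_eq_rpow, Real.sqrt_sq hα.le]
  have e2 : (y / α) ^ 2 * (α ^ 2 * X) = y ^ 2 * X := by field_simp
  rw [e, e2]
  field_simp

/-- Uniqueness up to scaling of the fixed point of the smoothing transform `𝔉_sm`:
any Borel probability measure on `[0,∞)`, other than the Dirac mass at `0`, which is
a fixed point of `𝔉_sm`, is a rescaled Rayleigh distribution. -/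
theorem smoothing_fixed_point_unique (μ : Measure ℝ) [IsProbabilityMeasure μ]
    (hsupp : μ (Set.Iio 0) = 0) (hne : μ ≠ Measure.dirac 0) (hfix : Fsm μ = μ) :
    ∃ α : ℝ, 0 < α ∧ Measure.map (fun x => α * x) μ = rayleigh := by
  obtain ⟨c, hc, h⟩ := fixed_MM hsupp hfix
  rcases hc.eq_or_lt with rfl | hc
  · exfalso
    refine hne (measure_unique hsupp (by simp) fun y hy => ?_)
    rw [h y (by linarith), MM_dirac (by linarith)]
  · have h2 : 0 < √2 := Real.sqrt_pos.2 (by norm_num)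
    have hα : 0 < (√2)⁻¹ / c := by positivity
    refine ⟨(√2)⁻¹ / c, hα, ?_⟩
    have hac : (√2)⁻¹ / c * c = (√2)⁻¹ := by field_simp
    set α := (√2)⁻¹ / c
    have hm : Measurable fun x : ℝ => α * x := by fun_prop
    have : IsProbabilityMeasure (Measure.map (fun x => α * x) μ) :=
      Measure.isProbabilityMeasure_map hm.aemeasurable
    refine measure_unique ?_ rayleigh_supp fun y hy => ?_
    · rw [Measure.map_apply hm measurableSet_Iio]
      refine measure_mono_null (fun x hx => ?_) hsupp
      have hx : α * x < 0 := hx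
      exact (pos_iff_neg_of_mul_neg hx).1 hα
    · have hy0 : 0 < y := by linarith
      rw [MM_map hα, h _ (by positivity), MM_rayleigh hy, ← hac]
      have : 0 < y + α * c := by positivity
      have e : y / α + c = (y + α * c) / α := by field_simp
      rw [e]
      generalize y + α * c = b at *
      field_simp
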